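/- Let d ≥ 1 and N ≥ 0 be integers. There exist: a radial potential V on ℝ^d, nonnegative, compactly supported, smooth on ℝ^d \ {0}, satisfying (log r)²/(C r²) ≤ V(r) ≤ C (log r)²/r² for all 0 < r ≤ r₀ (for some constants C > 0 and r₀ > 0); a strictly increasing sequence (λ_n)_{n ≥ n₀} of positive reals tending to +∞; constants 0 < c₁ < c₂; and sequences of smooth radial functions (u_n) and (f_n) on ℝ^d with supp u_n ⊆ {x : c₁ (log λ_n)/λ_n ≤ |x| ≤ c₂ (log λ_n)/λ_n}, such that, writing ũ_n, f̃_n, Ṽ for the radial profiles, the ordinary differential equation −ũ_n''(r) − ((d−1)/r) ũ_n'(r) + Ṽ(r) ũ_n(r) − λ_n² ũ_n(r) = f̃_n(r) holds for all r > 0, the L¹(ℝ^d) norm of u_n equals 1 for every n, and for every j ∈ ℕ one has sup_r |d^j f̃_n/dr^j (r)| = O(λ_n^{j−N}) as n → ∞. -/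

import Mathlib

open MeasureTheory Filter

/-- A smooth cutoff on the line centred at `c`. -/
theorem exists_smooth_cutoff (c a b : ℝ) (ha : 0 < a) (hab : a < b) :
    ∃ φ : ℝ → ℝ, ContDiff ℝ (⊤ : ℕ∞) φ ∧ (∀ s, 0 ≤ φ s) ∧ (∀ s, φ s ≤ 1) ∧
      (∀ s, |s - c| ≤ a → φ s = 1) ∧ (∀ s, b ≤ |s - c| → φ s = 0) := by
  let φ : ContDiffBump c := ⟨a, b, ha, hab⟩
  refine ⟨φ, φ.contDiff, fun s => φ.nonneg, fun s => φ.le_one, fun s hs => ?_, fun s hs => ?_⟩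
  · exact φ.one_of_mem_closedBall (by rwa [Metric.mem_closedBall, Real.dist_eq])
  · exact φ.zero_of_le_dist (by rwa [Real.dist_eq])

theorem contDiff_deriv_of_smooth {φ : ℝ → ℝ} (h : ContDiff ℝ (⊤ : ℕ∞) φ) :
    ContDiff ℝ (⊤ : ℕ∞) (deriv φ) :=
  (contDiff_infty_iff_deriv.1 h).2

theorem deriv_eq_zero_off {φ : ℝ → ℝ} {b c : ℝ} (h : ∀ s, b ≤ |s - c| → φ s = 0)
    {s : ℝ} (hs : b < |s - c|) : deriv φ s = 0 := by
  have : φ =ᶠ[nhds s] fun _ => (0 : ℝ) := by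
    have ho : IsOpen {x : ℝ | b < |x - c|} := isOpen_lt continuous_const (by fun_prop)
    filter_upwards [ho.mem_nhds hs] with x hx using h x (le_of_lt hx)
  rw [this.deriv_eq, deriv_const]

theorem deriv_deriv_eq_zero_off {φ : ℝ → ℝ} {b c : ℝ} (h : ∀ s, b ≤ |s - c| → φ s = 0)
    {s : ℝ} (hs : b < |s - c|) : deriv (deriv φ) s = 0 := by
  obtain ⟨b', hb, hs'⟩ := exists_between hs
  exact deriv_eq_zero_off (b := b') (fun x hx => deriv_eq_zero_off h (hb.trans_le hx)) hs'

theorem hasCompactSupport_of_zero_off {φ : ℝ → ℝ} {b c : ℝ} (h : ∀ s, b < |s - c| → φ s = 0) :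
    HasCompactSupport φ := by
  refine HasCompactSupport.intro (isCompact_closedBall c b) fun x hx => h x ?_
  rwa [Metric.mem_closedBall, Real.dist_eq, not_le] at hx

theorem exists_abs_bound {φ : ℝ → ℝ} (hc : Continuous φ) (h : HasCompactSupport φ) :
    ∃ C, 0 < C ∧ ∀ s, |φ s| ≤ C := by
  obtain ⟨C, hC⟩ := h.exists_bound_of_continuous hc
  exact ⟨|C| + 1, by positivity, fun s => (hC s).trans ((le_abs_self C).trans (by linarith))⟩

/-- A profile which is smooth on `(0, ∞)` defines a function smooth off the origin. -/
theorem contDiffOn_radial {d : ℕ} {φ : ℝ → ℝ} (h : ∀ r, 0 < r → ContDiffAt ℝ (⊤ : ℕ∞) φ r) :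
    ContDiffOn ℝ (⊤ : ℕ∞) (fun x : EuclideanSpace ℝ (Fin d) => φ ‖x‖) {0}ᶜ := by
  intro x hx
  have hx : x ≠ 0 := hx
  exact ((h ‖x‖ (norm_pos_iff.2 hx)).comp x (contDiffAt_norm ℝ hx)).contDiffWithinAt

theorem contDiff_radial {d : ℕ} {φ : ℝ → ℝ} {δ : ℝ} (h : ContDiff ℝ (⊤ : ℕ∞) φ) (hδ : 0 < δ)
    (h0 : ∀ r, r < δ → φ r = 0) :
    ContDiff ℝ (⊤ : ℕ∞) (fun x : EuclideanSpace ℝ (Fin d) => φ ‖x‖) := by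
  rw [contDiff_iff_contDiffAt]
  intro x
  by_cases hx : x = 0
  · have : (fun x : EuclideanSpace ℝ (Fin d) => φ ‖x‖) =ᶠ[nhds x] fun _ => (0 : ℝ) := by
      subst hx
      filter_upwards [Metric.ball_mem_nhds (0 : EuclideanSpace ℝ (Fin d)) hδ] with y hy
      exact h0 _ (by simpa using hy)
    exact contDiffAt_const.congr_of_eventuallyEq this
  · exact (h.contDiffAt).comp x (contDiffAt_norm ℝ hx)

/-- The zeroth-order coefficient making `exp (ν M β)` a null solution of the radial operator. -/
noncomputable def wellPotential (d M : ℝ) (β : ℝ → ℝ) (ν s : ℝ) : ℝ :=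
  ν ^ 2 * M ^ 2 * deriv β s ^ 2 + ν * M * (deriv (deriv β) s + (d - 1) / s * deriv β s)

/-- The background `(log r)^2 / r^2`, replaced by a well of depth `(ν e^ν)^2` at scale `e^{-ν}`. -/
noncomputable def scalePotential (d M : ℝ) (β ψ : ℝ → ℝ) (ν r : ℝ) : ℝ :=
  Real.log r ^ 2 / r ^ 2 + ψ (r * Real.exp ν) *
    (Real.exp ν ^ 2 * (ν ^ 2 + wellPotential d M β ν (r * Real.exp ν)) - Real.log r ^ 2 / r ^ 2)

/-- The potential carrying one well at each exponential scale. -/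
noncomputable def multiscalePotential (d M : ℝ) (β ψ : ℝ → ℝ) (r : ℝ) : ℝ :=
  scalePotential d M β ψ (-(⌊Real.log r⌋ : ℝ)) r

section potential

variable {d M : ℝ} {β ψ : ℝ → ℝ}

theorem scalePotential_eq_background (hψ0 : ∀ s, 3 / 5 ≤ |s - 2| → ψ s = 0) {ν r : ℝ}
    (h : 3 / 5 ≤ |r * Real.exp ν - 2|) :
    scalePotential d M β ψ ν r = Real.log r ^ 2 / r ^ 2 := by
  simp [scalePotential, hψ0 _ h]

theorem one_le_mul_exp_neg_floor_log {r : ℝ} (hr : 0 < r) :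
    1 ≤ r * Real.exp (-(⌊Real.log r⌋ : ℝ)) := by
  have h := Int.floor_le (Real.log r)
  nth_rewrite 1 [← Real.exp_log hr]
  rw [← Real.exp_add]
  exact Real.one_le_exp (by linarith)

theorem mul_exp_neg_floor_log_lt {r : ℝ} (hr : 0 < r) :
    r * Real.exp (-(⌊Real.log r⌋ : ℝ)) < Real.exp 1 := by
  have h := Int.lt_floor_add_one (Real.log r)
  nth_rewrite 1 [← Real.exp_log hr]
  rw [← Real.exp_add]
  exact Real.exp_lt_exp.2 (by linarith)

theorem multiscalePotential_eq_scalePotential (hψ0 : ∀ s, 3 / 5 ≤ |s - 2| → ψ s = 0) {m : ℤ}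
    {r : ℝ} (hr : 0 < r) (h1 : 13 / 5 < r * Real.exp (-(m : ℝ)) * Real.exp 1)
    (h2 : r * Real.exp (-(m : ℝ)) < 7 / 5 * Real.exp 1) :
    multiscalePotential d M β ψ r = scalePotential d M β ψ (-(m : ℝ)) r := by
  have he := Real.exp_one_gt_d9
  have hk1 := one_le_mul_exp_neg_floor_log hr
  have hk2 := mul_exp_neg_floor_log_lt hr
  unfold multiscalePotential
  set k := ⌊Real.log r⌋ with hk
  have hks : Real.exp (-(k : ℝ)) = Real.exp (-(m : ℝ)) * Real.exp ((m : ℝ) - k) := by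
    rw [← Real.exp_add]; congr 1; ring
  rw [hks, ← mul_assoc] at hk1 hk2
  have hpos : 0 < r * Real.exp (-(m : ℝ)) := by positivity
  rcases lt_trichotomy k m with hlt | heq | hgt
  · have hx : (1 : ℝ) ≤ (m : ℝ) - k := by
      have : ((k + 1 : ℤ) : ℝ) ≤ m := by exact_mod_cast hlt
      push_cast at this; linarith
    have hx := Real.exp_le_exp.2 hx
    rw [scalePotential_eq_background hψ0, scalePotential_eq_background hψ0]
    · rw [abs_of_nonpos] <;> nlinarith
    · rw [hks, ← mul_assoc, abs_of_nonneg] <;> nlinarith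
  · rw [heq]
  · have hx : (m : ℝ) - k ≤ -1 := by
      have : ((m + 1 : ℤ) : ℝ) ≤ k := by exact_mod_cast hgt
      push_cast at this; linarith
    have hx := Real.exp_le_exp.2 hx
    have hee : Real.exp (-1) * Real.exp 1 = 1 := by rw [← Real.exp_add]; simp
    have hep := Real.exp_pos ((m : ℝ) - k)
    have hx' : Real.exp ((m : ℝ) - k) * Real.exp 1 ≤ 1 := by nlinarith
    have hs : Real.exp 1 ≤ r * Real.exp (-(m : ℝ)) := by nlinarith
    have ht : r * Real.exp (-(m : ℝ)) * Real.exp ((m : ℝ) - k) ≤ 7 / 5 := by nlinarith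
    rw [scalePotential_eq_background hψ0, scalePotential_eq_background hψ0]
    · rw [abs_of_nonneg] <;> nlinarith
    · rw [hks, ← mul_assoc, abs_of_nonpos] <;> nlinarith

theorem contDiffAt_scalePotential (hβ : ContDiff ℝ (⊤ : ℕ∞) β) (hψ : ContDiff ℝ (⊤ : ℕ∞) ψ)
    {ν r : ℝ} (hr : 0 < r) : ContDiffAt ℝ (⊤ : ℕ∞) (scalePotential d M β ψ ν) r := by
  have h1 := contDiff_deriv_of_smooth hβ
  have h2 := contDiff_deriv_of_smooth h1
  have hlog : ContDiffAt ℝ (⊤ : ℕ∞) (fun x => Real.log x ^ 2 / x ^ 2) r :=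
    ((Real.contDiffAt_log.2 hr.ne').pow 2).div (contDiffAt_id.pow 2) (by positivity)
  have hs : ContDiff ℝ (⊤ : ℕ∞) (fun x : ℝ => x * Real.exp ν) := by fun_prop
  have hdiv : ContDiffAt ℝ (⊤ : ℕ∞) (fun x : ℝ => (d - 1) / (x * Real.exp ν)) r :=
    contDiffAt_const.div hs.contDiffAt (by positivity)
  have e1 := (h1.comp hs).contDiffAt (x := r)
  have e2 := (h2.comp hs).contDiffAt (x := r)
  have e3 := (hψ.comp hs).contDiffAt (x := r)
  have hw : ContDiffAt ℝ (⊤ : ℕ∞) (fun x => wellPotential d M β ν (x * Real.exp ν)) r :=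
    (contDiffAt_const.mul (e1.pow 2)).add (contDiffAt_const.mul (e2.add (hdiv.mul e1)))
  exact hlog.add (e3.mul ((contDiffAt_const.mul (contDiffAt_const.add hw)).sub hlog))

theorem contDiffAt_multiscalePotential (hβ : ContDiff ℝ (⊤ : ℕ∞) β)
    (hψ : ContDiff ℝ (⊤ : ℕ∞) ψ) (hψ0 : ∀ s, 3 / 5 ≤ |s - 2| → ψ s = 0) {r : ℝ} (hr : 0 < r) :
    ContDiffAt ℝ (⊤ : ℕ∞) (multiscalePotential d M β ψ) r := by
  refine (contDiffAt_scalePotential (d := d) (M := M) hβ hψ hr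
    (ν := -(⌊Real.log r⌋ : ℝ))).congr_of_eventuallyEq ?_
  have he := Real.exp_one_gt_d9
  have hk1 := one_le_mul_exp_neg_floor_log hr
  have hk2 := mul_exp_neg_floor_log_lt hr
  have ev1 : ∀ᶠ x in nhds r, 13 / 5 < x * Real.exp (-(⌊Real.log r⌋ : ℝ)) * Real.exp 1 :=
    (isOpen_lt continuous_const (by fun_prop)).mem_nhds (by simp only [Set.mem_ofPred_eq]; nlinarith)
  have ev2 : ∀ᶠ x in nhds r, x * Real.exp (-(⌊Real.log r⌋ : ℝ)) < 7 / 5 * Real.exp 1 :=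
    (isOpen_lt (by fun_prop) continuous_const).mem_nhds (by simp only [Set.mem_ofPred_eq]; nlinarith)
  filter_upwards [ev1, ev2, lt_mem_nhds hr] with x h1 h2 h0
  exact multiscalePotential_eq_scalePotential hψ0 h0 h1 h2


theorem exists_wellPotential_bounds (hβ : ContDiff ℝ (⊤ : ℕ∞) β)
    (hβ0 : ∀ s, 2 / 5 ≤ |s - 2| → β s = 0) (hd : 1 ≤ d) (hM : 0 ≤ M) :
    ∃ ν₀ K : ℝ, 2 ≤ ν₀ ∧ 1 ≤ K ∧ ∀ ν, ν₀ ≤ ν → ∀ s, 1 ≤ s →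
      ν ^ 2 / 2 ≤ ν ^ 2 + wellPotential d M β ν s ∧
      ν ^ 2 + wellPotential d M β ν s ≤ K * ν ^ 2 := by
  have h1 := contDiff_deriv_of_smooth hβ
  have h2 := contDiff_deriv_of_smooth h1
  obtain ⟨C₁, hC₁, hb₁⟩ := exists_abs_bound h1.continuous
    (hasCompactSupport_of_zero_off fun s hs => deriv_eq_zero_off hβ0 hs)
  obtain ⟨C₂, hC₂, hb₂⟩ := exists_abs_bound h2.continuous
    (hasCompactSupport_of_zero_off fun s hs => deriv_deriv_eq_zero_off hβ0 hs)
  set B := C₂ + (d - 1) * C₁ with hB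
  have hB0 : 0 ≤ B := by have := mul_nonneg (sub_nonneg.2 hd) hC₁.le; linarith
  have hMB : 0 ≤ M * B := mul_nonneg hM hB0
  refine ⟨2 + 2 * (M * B), 1 + M ^ 2 * C₁ ^ 2 + 1, by linarith, ?_, fun ν hν s hs => ?_⟩
  · have : 0 ≤ M ^ 2 * C₁ ^ 2 := by positivity
    linarith
  have hds : 0 ≤ (d - 1) / s ∧ (d - 1) / s ≤ d - 1 :=
    ⟨div_nonneg (by linarith) (by linarith), div_le_self (by linarith) hs⟩
  have hE : |deriv (deriv β) s + (d - 1) / s * deriv β s| ≤ B := by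
    refine (abs_add_le _ _).trans (add_le_add (hb₂ s) ?_)
    rw [abs_mul, abs_of_nonneg hds.1]
    exact mul_le_mul hds.2 (hb₁ s) (abs_nonneg _) (by linarith)
  have hsq : deriv β s ^ 2 ≤ C₁ ^ 2 := sq_le_sq' (abs_le.1 (hb₁ s)).1 (abs_le.1 (hb₁ s)).2
  have hν0 : 0 ≤ ν := by linarith
  have hprod : |ν * M * (deriv (deriv β) s + (d - 1) / s * deriv β s)| ≤ ν ^ 2 / 2 := by
    rw [abs_mul, abs_of_nonneg (mul_nonneg hν0 hM)]
    have := mul_le_mul_of_nonneg_left hE (mul_nonneg hν0 hM)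
    nlinarith
  have hmain : ν ^ 2 * M ^ 2 * deriv β s ^ 2 ≤ ν ^ 2 * M ^ 2 * C₁ ^ 2 := by gcongr
  have hmain0 : 0 ≤ ν ^ 2 * M ^ 2 * deriv β s ^ 2 := by positivity
  have := abs_le.1 hprod
  unfold wellPotential
  constructor <;> nlinarith

theorem multiscalePotential_bounds {ν₀ K : ℝ} (hν₀ : 2 ≤ ν₀) (hK : 1 ≤ K)
    (hψn : ∀ s, 0 ≤ ψ s) (hψ1 : ∀ s, ψ s ≤ 1)
    (h : ∀ ν, ν₀ ≤ ν → ∀ s, 1 ≤ s →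
      ν ^ 2 / 2 ≤ ν ^ 2 + wellPotential d M β ν s ∧
      ν ^ 2 + wellPotential d M β ν s ≤ K * ν ^ 2)
    {r : ℝ} (hr : 0 < r) (hlog : Real.log r < -ν₀) :
    Real.log r ^ 2 / r ^ 2 / 2 ≤ multiscalePotential d M β ψ r ∧
      multiscalePotential d M β ψ r ≤ 36 * K * (Real.log r ^ 2 / r ^ 2) := by
  have he := Real.exp_one_lt_d9
  have hs1 := one_le_mul_exp_neg_floor_log hr
  have hs2 := mul_exp_neg_floor_log_lt hr
  have hf1 := Int.floor_le (Real.log r)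
  have hf2 := Int.lt_floor_add_one (Real.log r)
  unfold multiscalePotential scalePotential
  set ν : ℝ := -(⌊Real.log r⌋ : ℝ) with hν
  set s := r * Real.exp ν with hs
  obtain ⟨hq1, hq2⟩ := h ν (by linarith) s hs1
  have hp0 := hψn s
  have hp1 := hψ1 s
  set p := ψ s
  set Q := ν ^ 2 + wellPotential d M β ν s
  set L := Real.log r
  have hexp : Real.exp ν = s / r := by rw [hs]; field_simp
  have hL1 : L ^ 2 ≤ ν ^ 2 := by nlinarith
  have hL2 : ν ^ 2 ≤ 4 * L ^ 2 := by nlinarith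
  have hS1 : 1 ≤ s ^ 2 := by nlinarith
  have hS2 : s ^ 2 ≤ 9 := by nlinarith
  have hQ0 : 0 ≤ Q := by nlinarith [sq_nonneg ν]
  have hsQ1 : L ^ 2 / 2 ≤ s ^ 2 * Q := by nlinarith
  have hKL : K * ν ^ 2 ≤ K * (4 * L ^ 2) := by gcongr
  have hsQ2 : s ^ 2 * Q ≤ 36 * K * L ^ 2 := by nlinarith
  have hKL1 : L ^ 2 ≤ 36 * K * L ^ 2 := by nlinarith [sq_nonneg L]
  have hrw : L ^ 2 / r ^ 2 + p * (Real.exp ν ^ 2 * Q - L ^ 2 / r ^ 2) =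
      (L ^ 2 + p * (s ^ 2 * Q - L ^ 2)) / r ^ 2 := by
    rw [hexp]; field_simp
  rw [hrw, div_right_comm, ← mul_div_assoc]
  constructor
  · gcongr
    nlinarith [sq_nonneg L]
  · gcongr
    nlinarith

theorem multiscalePotential_eq_well (hψ : ∀ s, |s - 2| ≤ 1 / 2 → ψ s = 1) {ν : ℤ} {r : ℝ}
    (hr : 0 < r) (h : |r * Real.exp ν - 2| ≤ 1 / 2) :
    multiscalePotential d M β ψ r =
      Real.exp ν ^ 2 * ((ν : ℝ) ^ 2 + wellPotential d M β ν (r * Real.exp ν)) := by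
  have he := Real.exp_one_gt_d9
  have hb := abs_le.1 h
  have hfl : ⌊Real.log r⌋ = -ν := by
    have hlog : Real.log (r * Real.exp ν) = Real.log r + ν := by
      rw [Real.log_mul hr.ne' (Real.exp_ne_zero _), Real.log_exp]
    have h1 : 0 ≤ Real.log (r * Real.exp ν) := Real.log_nonneg (by linarith)
    have h2 : Real.log (r * Real.exp ν) < 1 := by
      rw [Real.log_lt_iff_lt_exp (by linarith)]; linarith
    rw [Int.floor_eq_iff]
    push_cast
    constructor <;> linarith
  rw [multiscalePotential, hfl]
  simp only [Int.cast_neg, neg_neg, scalePotential, hψ _ h]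
  ring

end potential

/-- The unnormalised mode: `exp (ν M β)` near the centre of the well, cut off by `χ`. -/
noncomputable def modeProfile (M : ℝ) (β χ : ℝ → ℝ) (ν s : ℝ) : ℝ :=
  χ s + Real.exp (ν * M * β s) - 1

/-- The error produced by the cutoff `χ`. -/
noncomputable def errorProfile (d : ℝ) (χ : ℝ → ℝ) (s : ℝ) : ℝ :=
  -deriv (deriv χ) s - (d - 1) / s * deriv χ s

section profile

variable {d M : ℝ} {β χ : ℝ → ℝ}

theorem contDiff_modeProfile (hβ : ContDiff ℝ (⊤ : ℕ∞) β) (hχ : ContDiff ℝ (⊤ : ℕ∞) χ) (ν : ℝ) :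
    ContDiff ℝ (⊤ : ℕ∞) (modeProfile M β χ ν) :=
  (hχ.add (contDiff_const.mul hβ).exp).sub contDiff_const

theorem modeProfile_eq_zero (hβ0 : ∀ s, 2 / 5 ≤ |s - 2| → β s = 0)
    (hχ0 : ∀ s, 1 / 2 ≤ |s - 2| → χ s = 0) (ν : ℝ) {s : ℝ} (hs : 1 / 2 ≤ |s - 2|) :
    modeProfile M β χ ν s = 0 := by
  simp [modeProfile, hβ0 s (by linarith), hχ0 s hs]

theorem errorProfile_eq_zero (hχ0 : ∀ s, 1 / 2 ≤ |s - 2| → χ s = 0) {s : ℝ}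
    (hs : 1 / 2 < |s - 2|) : errorProfile d χ s = 0 := by
  simp [errorProfile, deriv_eq_zero_off hχ0 hs, deriv_deriv_eq_zero_off hχ0 hs]

theorem contDiff_errorProfile (hχ : ContDiff ℝ (⊤ : ℕ∞) χ)
    (hχ0 : ∀ s, 1 / 2 ≤ |s - 2| → χ s = 0) : ContDiff ℝ (⊤ : ℕ∞) (errorProfile d χ) := by
  have h1 := contDiff_deriv_of_smooth hχ
  have h2 := contDiff_deriv_of_smooth h1
  rw [contDiff_iff_contDiffAt]
  intro s
  by_cases hs : s < 1
  · have : errorProfile d χ =ᶠ[nhds s] fun _ => (0 : ℝ) := by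
      filter_upwards [gt_mem_nhds hs] with x hx
      exact errorProfile_eq_zero hχ0 (by rw [abs_of_neg] <;> linarith)
    exact contDiffAt_const.congr_of_eventuallyEq this
  · exact h2.contDiffAt.neg.sub ((contDiffAt_const.div contDiffAt_id (by simp; linarith)).mul
      h1.contDiffAt)

theorem deriv_modeProfile (hβ : ContDiff ℝ (⊤ : ℕ∞) β) (hχ : ContDiff ℝ (⊤ : ℕ∞) χ) (ν : ℝ) :
    deriv (modeProfile M β χ ν) = fun s =>
      deriv χ s + Real.exp (ν * M * β s) * (ν * M * deriv β s) := by
  funext s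
  have hb : HasDerivAt β (deriv β s) s := (hβ.differentiable (by simp) s).hasDerivAt
  have hc : HasDerivAt χ (deriv χ s) s := (hχ.differentiable (by simp) s).hasDerivAt
  exact ((hc.add (hb.const_mul (ν * M)).exp).sub_const 1).deriv

theorem deriv_deriv_modeProfile (hβ : ContDiff ℝ (⊤ : ℕ∞) β) (hχ : ContDiff ℝ (⊤ : ℕ∞) χ)
    (ν s : ℝ) :
    deriv (deriv (modeProfile M β χ ν)) s = deriv (deriv χ) s +
      Real.exp (ν * M * β s) * (ν ^ 2 * M ^ 2 * deriv β s ^ 2 + ν * M * deriv (deriv β) s) := by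
  rw [deriv_modeProfile hβ hχ]
  have hb : HasDerivAt β (deriv β s) s := (hβ.differentiable (by simp) s).hasDerivAt
  have hb' : HasDerivAt (deriv β) (deriv (deriv β) s) s :=
    ((contDiff_deriv_of_smooth hβ).differentiable (by simp) s).hasDerivAt
  have hc' : HasDerivAt (deriv χ) (deriv (deriv χ) s) s :=
    ((contDiff_deriv_of_smooth hχ).differentiable (by simp) s).hasDerivAt
  refine (hc'.add ((hb.const_mul (ν * M)).exp.mul (hb'.const_mul (ν * M)))).deriv.trans ?_
  ring

theorem wellPotential_mul_modeProfile (hβ0 : ∀ s, 2 / 5 ≤ |s - 2| → β s = 0)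
    (hχ1 : ∀ s, |s - 2| ≤ 9 / 20 → χ s = 1) (ν s : ℝ) :
    wellPotential d M β ν s * modeProfile M β χ ν s =
      wellPotential d M β ν s * Real.exp (ν * M * β s) := by
  rcases le_or_gt |s - 2| (9 / 20) with h | h
  · simp [modeProfile, hχ1 s h]
  · have h : 2 / 5 < |s - 2| := by linarith
    simp [wellPotential, deriv_eq_zero_off hβ0 h, deriv_deriv_eq_zero_off hβ0 h]

theorem modeProfile_equation (hβ : ContDiff ℝ (⊤ : ℕ∞) β) (hχ : ContDiff ℝ (⊤ : ℕ∞) χ)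
    (hβ0 : ∀ s, 2 / 5 ≤ |s - 2| → β s = 0) (hχ1 : ∀ s, |s - 2| ≤ 9 / 20 → χ s = 1) (ν s : ℝ) :
    -deriv (deriv (modeProfile M β χ ν)) s - (d - 1) / s * deriv (modeProfile M β χ ν) s +
      wellPotential d M β ν s * modeProfile M β χ ν s = errorProfile d χ s := by
  rw [wellPotential_mul_modeProfile hβ0 hχ1, deriv_deriv_modeProfile hβ hχ,
    deriv_modeProfile hβ hχ, wellPotential, errorProfile]
  ring

end profile

section scaling

theorem deriv_rescale {φ : ℝ → ℝ} (h : Differentiable ℝ φ) (c I : ℝ) :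
    deriv (fun r => φ (r * c) / I) = fun r => c * (deriv φ (r * c) / I) := by
  funext r
  have := (((h (r * c)).hasDerivAt.comp r ((hasDerivAt_id r).mul_const c)).div_const I).deriv
  refine Eq.trans this ?_
  ring

theorem deriv_deriv_rescale {φ : ℝ → ℝ} (h : ContDiff ℝ (⊤ : ℕ∞) φ) (c I r : ℝ) :
    deriv (deriv fun r => φ (r * c) / I) r = c ^ 2 * deriv (deriv φ) (r * c) / I := by
  rw [deriv_rescale (h.differentiable (by simp)), deriv_const_mul_field,
    deriv_rescale ((contDiff_deriv_of_smooth h).differentiable (by simp))]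
  ring

theorem iteratedDeriv_rescale {φ : ℝ → ℝ} (h : ContDiff ℝ (⊤ : ℕ∞) φ) (c A : ℝ) (j : ℕ) (r : ℝ) :
    iteratedDeriv j (fun r => A * φ (r * c)) r = A * (c ^ j * iteratedDeriv j φ (r * c)) := by
  rw [iteratedDeriv_const_mul_field]
  have := congrFun (iteratedDeriv_comp_const_mul (n := j) (h.of_le (by exact_mod_cast le_top)) c) r
  simp only [mul_comm c] at this
  rw [this]

theorem exists_abs_iteratedDeriv_bound {φ : ℝ → ℝ} (h : ContDiff ℝ (⊤ : ℕ∞) φ)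
    (hc : HasCompactSupport φ) (j : ℕ) : ∃ C, 0 < C ∧ ∀ s, |iteratedDeriv j φ s| ≤ C := by
  refine exists_abs_bound (h.continuous_iteratedDeriv j (by exact_mod_cast le_top)) ?_
  refine hc.mono' ?_
  have := support_iteratedFDeriv_subset (𝕜 := ℝ) (f := φ) j
  intro x hx
  refine this ?_
  rw [Function.mem_support] at hx ⊢
  contrapose! hx
  rw [iteratedDeriv_eq_iteratedFDeriv, hx]; rfl

theorem integral_rescale {d : ℕ} (φ : ℝ → ℝ) {c : ℝ} (hc : 0 < c) :
    ∫ x : EuclideanSpace ℝ (Fin d), φ (‖x‖ * c) =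
      (c ^ d)⁻¹ * ∫ x : EuclideanSpace ℝ (Fin d), φ ‖x‖ := by
  have := Measure.integral_comp_smul (volume : Measure (EuclideanSpace ℝ (Fin d)))
    (fun x => φ ‖x‖) c
  simp only [norm_smul, Real.norm_eq_abs, abs_of_pos hc, finrank_euclideanSpace_fin, smul_eq_mul,
    abs_of_pos (inv_pos.2 (pow_pos hc d))] at this
  simpa only [mul_comm c] using this

theorem exists_modeProfile_integral_bound {d : ℕ} (hd : 1 ≤ d) {M : ℝ} {β χ : ℝ → ℝ}
    (hβ : Continuous β) (hχ : Continuous χ)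
    (hβ0 : ∀ s, 2 / 5 ≤ |s - 2| → β s = 0) (hβ1 : ∀ s, |s - 2| ≤ 1 / 5 → β s = 1)
    (hχ0 : ∀ s, 1 / 2 ≤ |s - 2| → χ s = 0) (hχ1 : ∀ s, |s - 2| ≤ 9 / 20 → χ s = 1) :
    ∃ κ : ℝ, 0 < κ ∧ ∀ ν, κ * Real.exp (ν * M) ≤
      ∫ x : EuclideanSpace ℝ (Fin d), |modeProfile M β χ ν ‖x‖| := by
  obtain ⟨γ, hγ, hγn, hγ1, hγone, hγ0⟩ :=
    exists_smooth_cutoff 2 (1 / 10) (1 / 5) (by norm_num) (by norm_num)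
  have hcpt : ∀ φ : ℝ → ℝ, (∀ s, 1 / 2 ≤ |s - 2| → φ s = 0) →
      HasCompactSupport (fun x : EuclideanSpace ℝ (Fin d) => φ ‖x‖) := by
    intro φ h
    refine HasCompactSupport.intro (isCompact_closedBall 0 3) fun x hx => h _ ?_
    rw [mem_closedBall_zero_iff, not_le] at hx
    rw [abs_of_pos] <;> linarith
  have hγc : HasCompactSupport (fun x : EuclideanSpace ℝ (Fin d) => γ ‖x‖) :=
    hcpt γ fun s hs => hγ0 s (by linarith)
  have hγcont : Continuous (fun x : EuclideanSpace ℝ (Fin d) => γ ‖x‖) :=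
    hγ.continuous.comp continuous_norm
  have : Nonempty (Fin d) := ⟨⟨0, hd⟩⟩
  obtain ⟨x₀, hx₀⟩ := exists_norm_eq (EuclideanSpace ℝ (Fin d)) (show (0 : ℝ) ≤ 2 by norm_num)
  refine ⟨∫ x : EuclideanSpace ℝ (Fin d), γ ‖x‖,
    hγcont.integral_pos_of_hasCompactSupport_nonneg_nonzero hγc (fun x => hγn _) (x := x₀) ?_,
    fun ν => ?_⟩
  · rw [hx₀, hγone 2 (by norm_num)]; exact one_ne_zero
  rw [← integral_mul_const]
  refine integral_mono ((hγcont.integrable_of_hasCompactSupport hγc).mul_const _) ?_ fun x => ?_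
  · refine Continuous.integrable_of_hasCompactSupport ?_
      (hcpt (fun s => |modeProfile M β χ ν s|) fun s hs => ?_)
    · unfold modeProfile; fun_prop
    · simp only [modeProfile_eq_zero hβ0 hχ0 ν hs, abs_zero]
  · rcases le_or_gt |‖x‖ - 2| (1 / 5) with h | h
    · simp only [modeProfile, hβ1 _ h, hχ1 _ (by linarith : |‖x‖ - 2| ≤ 9 / 20)]
      rw [add_sub_cancel_left, mul_one, abs_of_pos (Real.exp_pos _)]
      exact mul_le_of_le_one_left (Real.exp_pos _).le (hγ1 _)
    · simp only [hγ0 _ h.le, zero_mul]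
      exact abs_nonneg _

end scaling

section frequency

theorem log_frequency_bounds {n : ℕ} (hn : 1 ≤ n) :
    (n : ℝ) ≤ Real.log (n * Real.exp n) ∧ Real.log (n * Real.exp n) ≤ 2 * n := by
  have h1 : (1 : ℝ) ≤ n := by exact_mod_cast hn
  rw [Real.log_mul (by positivity) (Real.exp_ne_zero _), Real.log_exp]
  constructor
  · linarith [Real.log_nonneg h1]
  · linarith [Real.log_le_sub_one_of_pos (show (0 : ℝ) < n by linarith)]

theorem exp_le_frequency_rpow {n : ℕ} (hn : 1 ≤ n) (j N : ℕ) :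
    Real.exp (n * ((j : ℝ) - 2 * N)) ≤ ((n : ℝ) * Real.exp n) ^ ((j : ℝ) - (N : ℝ)) := by
  obtain ⟨h1, h2⟩ := log_frequency_bounds hn
  have hn' : (1 : ℝ) ≤ n := by exact_mod_cast hn
  rw [Real.rpow_def_of_pos (by positivity)]
  refine Real.exp_le_exp.2 ?_
  have := mul_le_mul_of_nonneg_right h1 (Nat.cast_nonneg (α := ℝ) j)
  have := mul_le_mul_of_nonneg_right h2 (Nat.cast_nonneg (α := ℝ) N)
  nlinarith

end frequency

/-- Main theorem: existence of a potential `V` on `ℝ^d`, smooth away from the pole at the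
origin, with singularity of size `(log r)^2 / r^2`, together with a sequence of quasi-modes
`u_n` (radial, smooth, `L¹`-normalized, concentrating at the pole) with quasi-mode errors
`f_n` of size `O(λ_n^{j-N})`. -/
theorem pole_potential_quasimodes (d N : ℕ) (hd : 1 ≤ d) :
    ∃ (V : EuclideanSpace ℝ (Fin d) → ℝ) (Vt : ℝ → ℝ) (C r₀ : ℝ),
      0 < C ∧ 0 < r₀ ∧
      (∀ x, V x = Vt ‖x‖) ∧
      (∀ x, 0 ≤ V x) ∧
      HasCompactSupport V ∧
      ContDiffOn ℝ (⊤ : ℕ∞) V {(0 : EuclideanSpace ℝ (Fin d))}ᶜ ∧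
      (∀ r : ℝ, 0 < r → r ≤ r₀ →
        (Real.log r) ^ 2 / (C * r ^ 2) ≤ Vt r ∧ Vt r ≤ C * (Real.log r) ^ 2 / r ^ 2) ∧
      ∃ (n₀ : ℕ) (lam : ℕ → ℝ) (c₁ c₂ : ℝ)
        (u f : ℕ → EuclideanSpace ℝ (Fin d) → ℝ) (ut ft : ℕ → ℝ → ℝ),
        0 < c₁ ∧ c₁ < c₂ ∧
        (∀ n, n₀ ≤ n → 0 < lam n) ∧
        StrictMonoOn lam (Set.Ici n₀) ∧
        Tendsto lam atTop atTop ∧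
        (∀ n, n₀ ≤ n → ContDiff ℝ (⊤ : ℕ∞) (u n) ∧ ContDiff ℝ (⊤ : ℕ∞) (f n)) ∧
        (∀ n, n₀ ≤ n → ∀ x, u n x = ut n ‖x‖) ∧
        (∀ n, n₀ ≤ n → ∀ x, f n x = ft n ‖x‖) ∧
        (∀ n, n₀ ≤ n → Function.support (u n) ⊆
          {x | c₁ * Real.log (lam n) / lam n ≤ ‖x‖ ∧ ‖x‖ ≤ c₂ * Real.log (lam n) / lam n}) ∧
        (∀ n, n₀ ≤ n → ∀ r : ℝ, 0 < r →
          -(deriv (deriv (ut n)) r) - ((d : ℝ) - 1) / r * deriv (ut n) r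
            + Vt r * ut n r - (lam n) ^ 2 * ut n r = ft n r) ∧
        (∀ n, n₀ ≤ n → ∫ x, |u n x| ∂(volume) = 1) ∧
        (∀ j : ℕ, ∃ C' : ℝ, 0 < C' ∧ ∀ᶠ n in atTop,
          ∀ r : ℝ, |iteratedDeriv j (ft n) r| ≤ C' * lam n ^ ((j : ℝ) - (N : ℝ))) := by
  obtain ⟨β, hβ, hβn, hβle, hβ1, hβ0⟩ :=
    exists_smooth_cutoff 2 (1 / 5) (2 / 5) (by norm_num) (by norm_num)
  obtain ⟨χ, hχ, hχn, hχle, hχ1, hχ0⟩ :=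
    exists_smooth_cutoff 2 (9 / 20) (1 / 2) (by norm_num) (by norm_num)
  obtain ⟨ψ, hψ, hψn, hψle, hψ1, hψ0⟩ :=
    exists_smooth_cutoff 2 (1 / 2) (3 / 5) (by norm_num) (by norm_num)
  have hd' : (1 : ℝ) ≤ d := by exact_mod_cast hd
  set M : ℝ := 2 * N + d + 2 with hM
  obtain ⟨ν₀, K, hν₀, hK, hwell⟩ := exists_wellPotential_bounds hβ hβ0 hd' (M := M) (by positivity)
  obtain ⟨κ, hκ, hint⟩ := exists_modeProfile_integral_bound hd (M := M) hβ.continuous hχ.continuous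
    hβ0 hβ1 hχ0 hχ1
  have hb := Real.exp_pos (-ν₀)
  obtain ⟨η, hη, hηn, hηle, hη1, hη0⟩ :=
    exists_smooth_cutoff 0 (Real.exp (-ν₀) / 2) (Real.exp (-ν₀)) (by positivity) (by linarith)
  have hbounds : ∀ r, 0 < r → r < Real.exp (-ν₀) →
      Real.log r ^ 2 / r ^ 2 / 2 ≤ multiscalePotential d M β ψ r ∧
      multiscalePotential d M β ψ r ≤ 36 * K * (Real.log r ^ 2 / r ^ 2) := fun r hr hrb =>
    multiscalePotential_bounds hν₀ hK hψn hψle hwell hr ((Real.log_lt_iff_lt_exp hr).2 hrb)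
  have hmode := contDiff_modeProfile (M := M) hβ hχ
  have herr := contDiff_errorProfile (d := d) hχ hχ0
  set I : ℕ → ℝ := fun n => ∫ x : EuclideanSpace ℝ (Fin d),
    |modeProfile M β χ n (‖x‖ * Real.exp n)| with hI
  have hIlow : ∀ n : ℕ, κ * Real.exp (n * (2 * N + 2)) ≤ I n := by
    intro n
    have hs := integral_rescale (d := d) (fun s => |modeProfile M β χ n s|) (Real.exp_pos n)
    simp only [hI, hs]
    have h := mul_le_mul_of_nonneg_left (hint n)
      (inv_nonneg.2 (pow_nonneg (Real.exp_pos (n : ℝ)).le d))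
    refine le_trans (le_of_eq ?_) h
    rw [← Real.exp_nat_mul, ← Real.exp_neg, mul_left_comm, ← Real.exp_add]
    congr 2
    rw [hM]; ring
  have hIpos : ∀ n, 0 < I n := fun n => lt_of_lt_of_le (by positivity) (hIlow n)
  have hn₀ : ∀ n : ℕ, ⌈ν₀⌉₊ + 2 ≤ n → 1 ≤ n ∧ 5 * Real.exp (-n) ≤ Real.exp (-ν₀) := by
    intro n hn
    refine ⟨by omega, ?_⟩
    have h1 : ν₀ + 2 ≤ n := by
      have : ((⌈ν₀⌉₊ + 2 : ℕ) : ℝ) ≤ n := by exact_mod_cast hn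
      push_cast at this
      linarith [Nat.le_ceil ν₀]
    have h2 : Real.exp (-n) * (Real.exp 1 * Real.exp 1) ≤ Real.exp (-ν₀) := by
      rw [← Real.exp_add, ← Real.exp_add]
      exact Real.exp_le_exp.2 (by linarith)
    have he := Real.exp_one_gt_d9
    have h3 : (5 : ℝ) ≤ Real.exp 1 * Real.exp 1 := by nlinarith
    have := mul_le_mul_of_nonneg_left h3 (Real.exp_pos (-(n : ℝ))).le
    linarith
  have hpos : ∀ n : ℕ, 1 ≤ n → (0 : ℝ) < n * Real.exp n := fun n hn => by
    have : (1 : ℝ) ≤ n := by exact_mod_cast hn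
    positivity
  have hδ : ∀ n : ℕ, ∀ r, r < Real.exp (-n) → r * Real.exp n < 1 := by
    intro n r hr
    have := mul_lt_mul_of_pos_right hr (Real.exp_pos (n : ℝ))
    rwa [← Real.exp_add, neg_add_cancel, Real.exp_zero] at this
  have hinv : ∀ (n : ℕ) (r : ℝ), r = r * Real.exp n * Real.exp (-n) := by
    intro n r
    rw [mul_assoc, ← Real.exp_add, add_neg_cancel, Real.exp_zero, mul_one]
  have habs : ∀ s : ℝ, s < 1 → 1 / 2 < |s - 2| := fun s hs => by
    rw [abs_of_neg] <;> linarith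
  have hmono : ∀ m n : ℕ, m < n → (m : ℝ) * Real.exp m < n * Real.exp n := by
    intro m n hmn
    have h : (m : ℝ) < n := by exact_mod_cast hmn
    have h' := Real.exp_lt_exp.2 h
    have := Nat.cast_nonneg (α := ℝ) m
    have := Real.exp_pos (m : ℝ)
    nlinarith
  refine ⟨fun x => η ‖x‖ * multiscalePotential d M β ψ ‖x‖,
    fun r => η r * multiscalePotential d M β ψ r, 36 * K, Real.exp (-ν₀) / 2, by positivity,
    by positivity, fun x => rfl, fun x => ?_, ?_, ?_, fun r hr hr₀ => ?_, ⌈ν₀⌉₊ + 2,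
    fun n => n * Real.exp n, 1 / 2, 3,
    fun n x => modeProfile M β χ n (‖x‖ * Real.exp n) / I n,
    fun n x => Real.exp n ^ 2 / I n * errorProfile d χ (‖x‖ * Real.exp n),
    fun n r => modeProfile M β χ n (r * Real.exp n) / I n,
    fun n r => Real.exp n ^ 2 / I n * errorProfile d χ (r * Real.exp n),
    by norm_num, by norm_num, fun n hn => hpos n (hn₀ n hn).1, fun m _ n _ hmn => hmono m n hmn,
    ?_, fun n hn => ⟨?_, ?_⟩, fun n _ x => rfl, fun n _ x => rfl, fun n hn x hx => ?_,
    fun n hn r hr => ?_, fun n hn => ?_, fun j => ?_⟩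
  · rcases (norm_nonneg x).eq_or_lt with h | h
    · simp [← h, multiscalePotential, scalePotential, hψ0 0 (by norm_num)]
    · rcases lt_or_ge ‖x‖ (Real.exp (-ν₀)) with h' | h'
      · exact mul_nonneg (hηn _) (le_trans (by positivity) (hbounds _ h h').1)
      · simp only [hη0 ‖x‖ (by rwa [sub_zero, abs_of_pos h]), zero_mul, le_refl]
  · refine HasCompactSupport.intro (isCompact_closedBall 0 (Real.exp (-ν₀))) fun x hx => ?_
    rw [mem_closedBall_zero_iff, not_le] at hx
    rw [hη0 _ (by rw [sub_zero, abs_of_nonneg (norm_nonneg x)]; exact hx.le), zero_mul]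
  · refine contDiffOn_radial (φ := fun r => η r * multiscalePotential d M β ψ r) fun r hr => ?_
    exact hη.contDiffAt.mul (contDiffAt_multiscalePotential hβ hψ hψ0 hr)
  · obtain ⟨h1, h2⟩ := hbounds r hr (by linarith)
    simp only [hη1 r (by rwa [sub_zero, abs_of_pos hr]), one_mul]
    refine ⟨le_trans ?_ h1, h2.trans (le_of_eq (by ring))⟩
    rw [div_div, mul_comm (r ^ 2)]
    gcongr
    linarith
  · exact tendsto_natCast_atTop_atTop.atTop_mul_atTop₀
      (Real.tendsto_exp_atTop.comp tendsto_natCast_atTop_atTop)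
  · refine contDiff_radial (φ := fun r => modeProfile M β χ n (r * Real.exp n) / I n)
      (δ := Real.exp (-n)) ?_ (Real.exp_pos _) fun r hr => ?_
    · exact ((hmode n).comp (contDiff_id.mul contDiff_const)).div_const _
    · simp only [modeProfile_eq_zero hβ0 hχ0 n (habs _ (hδ n r hr)).le, zero_div]
  · refine contDiff_radial
      (φ := fun r => Real.exp n ^ 2 / I n * errorProfile d χ (r * Real.exp n))
      (δ := Real.exp (-n)) ?_ (Real.exp_pos _) fun r hr => ?_
    · exact contDiff_const.mul (herr.comp (contDiff_id.mul contDiff_const))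
    · simp only [errorProfile_eq_zero hχ0 (habs _ (hδ n r hr)), mul_zero]
  · obtain ⟨hn1, -⟩ := hn₀ n hn
    have hs : |‖x‖ * Real.exp n - 2| < 1 / 2 := by
      by_contra! h
      exact hx (by simp only [modeProfile_eq_zero hβ0 hχ0 n h, zero_div])
    have hs := abs_lt.1 hs
    obtain ⟨hl1, hl2⟩ := log_frequency_bounds hn1
    have hn1' : (1 : ℝ) ≤ n := by exact_mod_cast hn1
    constructor
    · rw [div_le_iff₀ (hpos n hn1)]
      nlinarith
    · rw [le_div_iff₀ (hpos n hn1)]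
      nlinarith
  · obtain ⟨hn1, hn2⟩ := hn₀ n hn
    have hc := Real.exp_pos (n : ℝ)
    have hV : (η r * multiscalePotential d M β ψ r) * modeProfile M β χ n (r * Real.exp n) =
        Real.exp n ^ 2 * ((n : ℝ) ^ 2 + wellPotential d M β n (r * Real.exp n)) *
          modeProfile M β χ n (r * Real.exp n) := by
      rcases le_or_gt (1 / 2) |r * Real.exp n - 2| with h | h
      · rw [modeProfile_eq_zero hβ0 hχ0 n h, mul_zero, mul_zero]
      · have hrη : η r = 1 := by
          refine hη1 r ?_
          rw [sub_zero, abs_of_pos hr, hinv n r]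
          have := (abs_lt.1 h).2
          have := Real.exp_pos (-(n : ℝ))
          nlinarith
        have := multiscalePotential_eq_well (d := d) (M := M) (β := β) hψ1 (ν := (n : ℤ)) hr
          (by simpa using h.le)
        rw [hrη, one_mul, this]
        simp
    rw [deriv_deriv_rescale (hmode n), deriv_rescale ((hmode n).differentiable (by simp))]
    simp only [← modeProfile_equation (M := M) hβ hχ hβ0 hχ1 n, ← mul_div_assoc, hV]
    have := (hIpos n).ne'
    field_simp
    ring
  · have h : ∀ x : EuclideanSpace ℝ (Fin d), |modeProfile M β χ n (‖x‖ * Real.exp n) / I n| =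
        |modeProfile M β χ n (‖x‖ * Real.exp n)| / I n := fun x => by
      rw [abs_div, abs_of_pos (hIpos n)]
    simp only [h]
    rw [integral_div]
    exact div_self (hIpos n).ne'
  · obtain ⟨C, hC, hbd⟩ := exists_abs_iteratedDeriv_bound herr
      (hasCompactSupport_of_zero_off fun s hs => errorProfile_eq_zero hχ0 hs) j
    refine ⟨C / κ, by positivity, ?_⟩
    filter_upwards [eventually_ge_atTop 1] with n hn r
    rw [iteratedDeriv_rescale herr]
    have hc := Real.exp_pos (n : ℝ)
    have hIn := hIpos n
    rw [abs_mul, abs_mul, abs_of_pos (by positivity : 0 < Real.exp (n : ℝ) ^ 2 / I n),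
      abs_of_pos (by positivity : 0 < Real.exp (n : ℝ) ^ j)]
    calc Real.exp n ^ 2 / I n *
          (Real.exp n ^ j * |iteratedDeriv j (errorProfile d χ) (r * Real.exp n)|)
        ≤ Real.exp n ^ 2 / (κ * Real.exp (n * (2 * N + 2))) * (Real.exp n ^ j * C) := by
          gcongr
          · exact hIlow n
          · exact hbd _
      _ = C / κ * Real.exp (n * ((j : ℝ) - 2 * N)) := by
          have : Real.exp (n * ((j : ℝ) - 2 * N)) =
              Real.exp n ^ 2 * Real.exp n ^ j / Real.exp (n * (2 * N + 2)) := by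
            rw [← Real.exp_nat_mul, ← Real.exp_nat_mul, ← Real.exp_add, ← Real.exp_sub]
            congr 1
            push_cast
            ring
          rw [this]
          field_simp
      _ ≤ C / κ * ((n : ℝ) * Real.exp n) ^ ((j : ℝ) - (N : ℝ)) := by
          gcongr
          exact exp_le_frequency_rpow hn j N
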